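/- arXiv:1904.10028 — 2 statements merged into one kernel-verified Lean document; each statement's English description precedes it below -/
import Mathlib

section
/- For every real ε > 0 there exist an integer n ≥ 0, a nonempty factor w of τ(φ^n(0)), and a period p of w such that |w|/p > 2 + √2/2 − ε. Hence the critical exponent of the infinite word r = τ(φ^ω(0)) is at least 2 + √2/2. -/
/-- Extension of a morphism (given on letters) to finite words by concatenation. -/
def applyM {α β : Type*} (h : α → List β) (w : List α) : List β := w.flatMap h

/-- The morphism φ on the alphabet {0,1,2}: φ(0)=01, φ(1)=02, φ(2)=022. -/
def phim : Fin 3 → List (Fin 3) := ![[0,1],[0,2],[0,2,2]]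

/-- The morphism τ to the binary alphabet: τ(0)=0, τ(1)=01, τ(2)=011. -/
def taum : Fin 3 → List (Fin 2) := ![[0],[0,1],[0,1,1]]

/-- `phipow n w` is the word φ^n(w). -/
def phipow (n : ℕ) (w : List (Fin 3)) : List (Fin 3) := (applyM phim)^[n] w

/-- `p` is a period of the finite word `w`: `1 ≤ p ≤ |w|` and `w[i] = w[i+p]`
for all valid indices. -/
def IsPeriod {α : Type*} (w : List α) (p : ℕ) : Prop :=
  0 < p ∧ p ≤ w.length ∧ ∀ i : ℕ, i + p < w.length → w[i]? = w[i+p]?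

theorem applyM_append {α β : Type*} (h : α → List β) (x y : List α) :
    applyM h (x ++ y) = applyM h x ++ applyM h y := List.flatMap_append

theorem applyM_cons {α β : Type*} (h : α → List β) (a : α) (x : List α) :
    applyM h (a :: x) = h a ++ applyM h x := List.flatMap_cons

theorem List.IsInfix.applyM {α β : Type*} (h : α → List β) {x y : List α} (hxy : x <:+: y) :
    applyM h x <:+: applyM h y := by
  obtain ⟨l, r, rfl⟩ := hxy
  exact ⟨_root_.applyM h l, _root_.applyM h r, by simp only [applyM_append]⟩

/-- The square of the morphism φ. -/
def phimSq (x : List (Fin 3)) : List (Fin 3) := applyM phim (applyM phim x)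

theorem phimSq_append (x y : List (Fin 3)) : phimSq (x ++ y) = phimSq x ++ phimSq y := by
  simp only [phimSq, applyM_append]

theorem phimSq_cons (a : Fin 3) (x : List (Fin 3)) :
    phimSq (a :: x) = phimSq [a] ++ phimSq x := phimSq_append [a] x

theorem phimSq_zero : phimSq [0] = [0, 1, 0, 2] := by decide

theorem phimSq_one : phimSq [1] = [0, 1, 0, 2, 2] := by decide

theorem phimSq_two : phimSq [2] = [0, 1, 0, 2, 2, 0, 2, 2] := by decide

theorem count_phimSq (x : List (Fin 3)) :
    (phimSq x).count 0 = 2 * x.count 0 + 2 * x.count 1 + 3 * x.count 2 ∧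
    (phimSq x).count 1 = x.count 0 + x.count 1 + x.count 2 ∧
    (phimSq x).count 2 = x.count 0 + 2 * x.count 1 + 4 * x.count 2 := by
  induction x with
  | nil => decide
  | cons a x ih =>
    obtain ⟨h0, h1, h2⟩ := ih
    rw [phimSq_cons]
    fin_cases a <;>
      simp [phimSq_zero, phimSq_one, phimSq_two, h0, h1, h2] <;> omega

theorem length_applyM_taum (x : List (Fin 3)) :
    (applyM taum x).length = x.count 0 + 2 * x.count 1 + 3 * x.count 2 := by
  induction x with
  | nil => rfl
  | cons a x ih =>
    rw [applyM_cons, List.length_append, ih]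
    fin_cases a <;> simp [taum] <;> omega

/-- Every word `φ²(x)0102` starts with the letter 0. -/
theorem exists_phimSq_append_eq_cons (x : List (Fin 3)) :
    ∃ y, phimSq x ++ [0, 1, 0, 2] = 0 :: y := by
  cases x with
  | nil => exact ⟨[1, 0, 2], rfl⟩
  | cons a x =>
    rw [phimSq_cons]
    fin_cases a <;> simp [phimSq_zero, phimSq_one, phimSq_two]

/-- A repetition `u0s = s0v` occurring in some `φ^n(0)`, with enough context to be transported by `φ²`. -/
structure IsRepetition (u s v : List (Fin 3)) : Prop where
  eq : u ++ 0 :: s = s ++ 0 :: v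
  exists_infix : ∃ n, 2 :: (u ++ 0 :: s) ++ [2] <:+: phipow n [0]

theorem IsRepetition.step {u s v : List (Fin 3)} (h : IsRepetition u s v) :
    ∃ v', IsRepetition (2 :: phimSq u ++ [0, 1]) (2 :: phimSq s ++ [0, 1, 0, 2]) v' := by
  obtain ⟨y, hy⟩ := exists_phimSq_append_eq_cons v
  refine ⟨y, ?_, ?_⟩
  · have := congrArg phimSq h.eq
    rw [phimSq_append, phimSq_append, phimSq_cons 0 s, phimSq_cons 0 v, phimSq_zero] at this
    rw [← hy]
    calc _ = 2 :: ((phimSq u ++ ([0, 1, 0, 2] ++ phimSq s)) ++ [0, 1, 0, 2]) := by simp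
      _ = _ := by rw [this]; simp
  · obtain ⟨n, hn⟩ := h.exists_infix
    refine ⟨n + 2, ?_⟩
    have := (hn.applyM phim).applyM phim
    rw [phipow, Function.iterate_succ_apply', Function.iterate_succ_apply']
    refine List.IsInfix.trans ?_ this
    change _ <:+: phimSq _
    rw [phimSq_append, phimSq_cons, phimSq_append, phimSq_cons 0 s, phimSq_zero, phimSq_two]
    exact ⟨[0, 1, 0, 2, 2, 0], [0, 2, 2], by simp⟩

/-- There are repetitions with arbitrarily long period, with controlled letter counts. -/
theorem exists_isRepetition (k : ℕ) :
    ∃ u s v, IsRepetition u s v ∧ k ≤ u.count 0 ∧ u.count 2 = u.count 0 ∧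
      u.count 0 ^ 2 + 2 * u.count 0 = 2 * u.count 0 * u.count 1 + u.count 1 ^ 2 ∧
      2 * s.count 0 = 3 * u.count 0 + u.count 1 ∧ 2 * s.count 1 = u.count 0 + u.count 1 ∧
      s.count 2 = s.count 0 := by
  induction k with
  | zero =>
    refine ⟨[2, 0, 1], [2, 0, 1, 0, 2], [1, 0, 2], ⟨rfl, 5, ?_⟩, by decide⟩
    decide
  | succ k ih =>
    obtain ⟨u, s, v, h, hk, hu2, hu, hs0, hs1, hs2⟩ := ih
    obtain ⟨v', h'⟩ := h.step
    refine ⟨_, _, v', h', ?_⟩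
    obtain ⟨cu0, cu1, cu2⟩ := count_phimSq u
    obtain ⟨cs0, cs1, cs2⟩ := count_phimSq s
    simp only [List.count_append, List.count_cons, List.cons_append, List.count_nil,
      cu0, cu1, cu2, cs0, cs1, cs2, hu2, hs2]
    simp
    refine ⟨by omega, by omega, ?_, by omega, by omega, by omega⟩
    nlinarith [hu]

theorem isPeriod_append {α : Type*} {x y z : List α} (h : x ++ y = y ++ z) (hx : x ≠ []) :
    IsPeriod (x ++ y) x.length := by
  refine ⟨List.length_pos_iff.2 hx, by simp, fun i hi => ?_⟩
  rw [List.length_append] at hi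
  have hright : (x ++ y)[i + x.length]? = y[i]? := by
    rw [List.getElem?_append_right (by omega), Nat.add_sub_cancel]
  rw [hright, h, List.getElem?_append_left (by omega)]

theorem sqrt_two_div_two_lt {P Q : ℝ} (hP : 0 < P) (hQ : 0 < Q) (h : P ^ 2 + 1 = 2 * Q ^ 2) :
    Real.sqrt 2 / 2 < Q / P := by
  rw [div_lt_div_iff₀ two_pos hP]
  refine lt_of_pow_lt_pow_left₀ 2 (by positivity) ?_
  rw [mul_pow, Real.sq_sqrt zero_le_two]
  nlinarith

theorem stmt8 (ε : ℝ) (hε : 0 < ε) :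
    ∃ (n : ℕ) (w : List (Fin 2)) (p : ℕ),
      w ≠ [] ∧ w <:+: applyM taum (phipow n [0]) ∧ IsPeriod w p ∧
      (w.length : ℝ) / p > 2 + Real.sqrt 2 / 2 - ε := by
  obtain ⟨k, hk⟩ := exists_nat_gt (2 / ε)
  obtain ⟨u, s, v, h, hku, hu2, hu, hs0, hs1, hs2⟩ := exists_isRepetition k
  obtain ⟨n, hn⟩ := h.exists_infix
  have heq : applyM taum (u ++ [0]) ++ applyM taum s =
      applyM taum s ++ applyM taum (0 :: v) := by
    rw [← applyM_append, ← applyM_append, ← h.eq, List.append_assoc, List.singleton_append]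
  have hP : (applyM taum (u ++ [0])).length = 4 * u.count 0 + 2 * u.count 1 + 1 := by
    rw [length_applyM_taum]
    simp
    omega
  have hS : (applyM taum s).length = 7 * u.count 0 + 3 * u.count 1 := by
    rw [length_applyM_taum]
    omega
  have hne : applyM taum (u ++ [0]) ≠ [] := by
    rw [← List.length_pos_iff, hP]
    omega
  refine ⟨n, _, _, List.append_ne_nil_of_left_ne_nil hne _, ?_, isPeriod_append heq hne, ?_⟩
  · rw [← applyM_append]
    refine List.IsInfix.applyM taum (List.IsInfix.trans ⟨[2], [2], ?_⟩ hn)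
    simp
  · rw [List.length_append, hP, hS]
    push_cast
    have hu' : (u.count 0 : ℝ) ^ 2 + 2 * u.count 0 =
        2 * u.count 0 * u.count 1 + (u.count 1 : ℝ) ^ 2 := by exact_mod_cast hu
    have hka : (k : ℝ) ≤ u.count 0 := by exact_mod_cast hku
    have ha : (0 : ℝ) ≤ u.count 0 := Nat.cast_nonneg _
    have hb : (0 : ℝ) ≤ u.count 1 := Nat.cast_nonneg _
    generalize (u.count 0 : ℝ) = a at *
    generalize (u.count 1 : ℝ) = b at *
    have hpos : 0 < 4 * a + 2 * b + 1 := by positivity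
    have hlt := sqrt_two_div_two_lt (Q := 3 * a + b + 1) hpos (by positivity) (by linarith)
    have hε' : 2 / (4 * a + 2 * b + 1) < ε := by
      rw [div_lt_iff₀ hε] at hk
      rw [div_lt_iff₀ hpos]
      nlinarith
    have hsplit : (4 * a + 2 * b + 1 + (7 * a + 3 * b)) / (4 * a + 2 * b + 1) =
        2 + (3 * a + b + 1) / (4 * a + 2 * b + 1) - 2 / (4 * a + 2 * b + 1) := by
      field_simp
      ring
    rw [hsplit]
    linarith
end

section
/- The critical exponent of the infinite word r = τ(φ^ω(0)) equals 2 + √2/2; that is, the supremum over all nonempty factors w of the words τ(φ^n(0)) (n ≥ 0) and all periods p of w of the real numbers |w|/p equals 2 + √2/2. -/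
/-! ### Hitting times of an irrational rotation -/

lemma fract_lt_of_sub_int {z δ : ℝ} (n : ℤ) (h0 : 0 ≤ z - n) (h1 : z - n < δ) :
    Int.fract z < δ := by
  have h : (n : ℝ) ≤ ⌊z⌋ := by exact_mod_cast Int.le_floor.2 (by linarith)
  have := Int.self_sub_floor z
  linarith

lemma exists_int_fract_lt {θ : ℝ} (hθ : Irrational θ) (x : ℝ) {δ : ℝ} (hδ : 0 < δ) :
    ∃ i : ℤ, Int.fract (x + i * θ) < δ := by
  have hd : Dense (AddSubgroup.closure {θ, 1} : Set ℝ) :=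
    dense_addSubgroupClosure_pair_iff.2 (by simpa using hθ)
  obtain ⟨z, hz, hz1, hz2⟩ := hd.exists_between (show -x < -x + δ by linarith)
  obtain ⟨i, j, rfl⟩ := AddSubgroup.mem_closure_pair.1 hz
  simp only [zsmul_eq_mul, mul_one] at hz1 hz2
  exact ⟨i, fract_lt_of_sub_int (-j) (by push_cast; linarith) (by push_cast; linarith)⟩

/-- If `a` steps of the rotation move forward by `u` and `b` steps move backward by `v`, then
an interval of length at least `max u v` is visited in any window of `a + b` steps. -/
lemma exists_hit_in_window {θ u v δ : ℝ} (hθ : Irrational θ) {a b : ℕ} (ha : 0 < a) (hb : 0 < b)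
    {k l : ℤ} (hak : a * θ = k + u) (hbl : b * θ = l - v) (hu : 0 < u) (hv : 0 < v)
    (huδ : u ≤ δ) (hvδ : v ≤ δ) (x : ℝ) (t : ℤ) :
    ∃ i : ℤ, t ≤ i ∧ i < t + a + b ∧ Int.fract (x + i * θ) < δ := by
  have next : ∀ i : ℤ, Int.fract (x + i * θ) < δ →
      ∃ j : ℤ, i < j ∧ j ≤ i + a + b ∧ Int.fract (x + j * θ) < δ := by
    intro i hi
    have h0 := Int.fract_nonneg (x + i * θ)
    have hf := Int.self_sub_floor (x + i * θ)
    by_cases h1 : Int.fract (x + i * θ) + u < δ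
    · refine ⟨i + a, by omega, by omega, fract_lt_of_sub_int (⌊x + i * θ⌋ + k) ?_ ?_⟩ <;>
        push_cast <;> linarith
    by_cases h2 : v ≤ Int.fract (x + i * θ)
    · refine ⟨i + b, by omega, by omega, fract_lt_of_sub_int (⌊x + i * θ⌋ + l) ?_ ?_⟩ <;>
        push_cast <;> linarith
    · refine ⟨i + a + b, by omega, by omega,
        fract_lt_of_sub_int (⌊x + i * θ⌋ + k + l) ?_ ?_⟩ <;>
        push_cast <;> linarith
  have prev : ∀ i : ℤ, Int.fract (x + i * θ) < δ →
      ∃ j : ℤ, j < i ∧ Int.fract (x + j * θ) < δ := by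
    intro i hi
    have h0 := Int.fract_nonneg (x + i * θ)
    have hf := Int.self_sub_floor (x + i * θ)
    by_cases h1 : Int.fract (x + i * θ) + v < δ
    · refine ⟨i - b, by omega, fract_lt_of_sub_int (⌊x + i * θ⌋ - l) ?_ ?_⟩ <;>
        push_cast <;> linarith
    by_cases h2 : u ≤ Int.fract (x + i * θ)
    · refine ⟨i - a, by omega, fract_lt_of_sub_int (⌊x + i * θ⌋ - k) ?_ ?_⟩ <;>
        push_cast <;> linarith
    · refine ⟨i - a - b, by omega, fract_lt_of_sub_int (⌊x + i * θ⌋ - k - l) ?_ ?_⟩ <;>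
        push_cast <;> linarith
  have early : ∃ i : ℤ, i < t + a + b ∧ Int.fract (x + i * θ) < δ := by
    by_contra! hcon
    obtain ⟨m, hm, hmin⟩ := Int.exists_least_of_bdd
      (P := fun i : ℤ => Int.fract (x + i * θ) < δ)
      ⟨t + a + b, fun z hz => by
        by_contra! hlt
        exact absurd hz (not_lt.2 (hcon z hlt))⟩
      (exists_int_fract_lt hθ x (hu.trans_le huδ))
    obtain ⟨j, hj, hjδ⟩ := prev m hm
    exact absurd (hmin j hjδ) (not_le.2 hj)
  obtain ⟨i, ⟨hi, hiδ⟩, hmax⟩ := Int.exists_greatest_of_bdd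
    (P := fun i : ℤ => i < t + a + b ∧ Int.fract (x + i * θ) < δ)
    ⟨t + a + b, fun z hz => hz.1.le⟩ early
  refine ⟨i, ?_, hi, hiδ⟩
  by_contra! hlt
  obtain ⟨j, hij, hj, hjδ⟩ := next i hiδ
  exact absurd (hmax j ⟨by omega, hjδ⟩) (not_le.2 hij)

/-- In the unimodular case the window length `a + b` is attained. -/
lemma not_hit_of_lt_add {θ u v δ : ℝ} {a b : ℕ} {k l : ℤ} (hdet : a * l - b * k = 1)
    (hak : a * θ = k + u) (hbl : b * θ = l - v) (hu : 0 < u) (hv : 0 < v)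
    {z : ℝ} (hzv : Int.fract z < v) (hzu : δ ≤ Int.fract z + u)
    {j : ℤ} (hj0 : 0 < j) (hj : j < a + b) : δ ≤ Int.fract (z + j * θ) := by
  by_contra! hlt
  have h0 := Int.fract_nonneg (z + j * θ)
  have hf := Int.self_sub_floor z
  have hf' := Int.self_sub_floor (z + j * θ)
  set n : ℤ := ⌊z + j * θ⌋ - ⌊z⌋ with hn
  obtain ⟨s, hs⟩ : ∃ s, s = j * l - n * b := ⟨_, rfl⟩
  obtain ⟨r, hr⟩ : ∃ r, r = a * n - k * j := ⟨_, rfl⟩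
  have hjs : j = s * a + r * b := by rw [hs, hr]; linear_combination (-j) * hdet
  have hns : n = s * k + r * l := by rw [hs, hr]; linear_combination (-n) * hdet
  have hmove : j * θ - n = s * u - r * v := by
    rw [hjs, hns]; push_cast; linear_combination (s : ℝ) * hak + r * hbl
  have hnR : (n : ℝ) = ⌊z + j * θ⌋ - ⌊z⌋ := by rw [hn]; push_cast; ring
  have hpos : Int.fract (z + j * θ) = Int.fract z + (s * u - r * v) := by linarith
  rcases le_or_gt s 0 with hs0 | hs0
  · rcases le_or_gt r 0 with hr0 | hr0
    · nlinarith
    · have h1 : (s : ℝ) ≤ 0 := by exact_mod_cast hs0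
      have h2 : (1 : ℝ) ≤ r := by exact_mod_cast hr0
      nlinarith
  · rcases le_or_gt r 0 with hr0 | hr0
    · have h1 : (1 : ℝ) ≤ s := by exact_mod_cast hs0
      have h2 : (r : ℝ) ≤ 0 := by exact_mod_cast hr0
      nlinarith
    · nlinarith

/-! ### Coding of the words by a rotation -/

/-- `c` is the `i`-th letter of `W` only if it is the parity of `⌊y - i√2⌋`. -/
def IsRotationCoding : ℝ → List (Fin 2) → Prop
  | _, [] => True
  | y, c :: W => ⌊y⌋ % 2 = (c : ℕ) ∧ IsRotationCoding (y - √2) W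

/-- `w` follows the orbit of `y` under the exchange of three intervals which is the first return
map of the rotation. -/
def IsExchangeCoding : ℝ → List (Fin 3) → Prop
  | _, [] => True
  | y, c :: w => ![0, 2 * √2 - 2, √2 - 1] c < y ∧ y < ![√2 - 1, 1, 2 * √2 - 2] c ∧
      IsExchangeCoding (y + ![2 - √2, 2 - 2 * √2, 4 - 3 * √2] c) w

lemma sqrt_two_mul_self : √2 * √2 = (2 : ℝ) := Real.mul_self_sqrt (by norm_num)

lemma sqrt_two_bounds : 1.414 < √2 ∧ √2 < (1.415 : ℝ) :=
  ⟨Real.lt_sqrt_of_sq_lt (by norm_num), (Real.sqrt_lt' (by norm_num)).2 (by norm_num)⟩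

lemma IsExchangeCoding.applyM_phim {w : List (Fin 3)} :
    ∀ {y : ℝ}, IsExchangeCoding y w → IsExchangeCoding ((√2 - 1) * (1 - y)) (applyM phim w) := by
  induction w with
  | nil => intro y _; trivial
  | cons c w ih =>
    rintro y ⟨h1, h2, h3⟩
    have key := ih h3
    have hsq := sqrt_two_mul_self
    obtain ⟨hl, hr⟩ := sqrt_two_bounds
    fin_cases c
    · simp [applyM, phim, IsExchangeCoding] at h1 h2 key ⊢
      refine ⟨by nlinarith, by nlinarith, by nlinarith, by nlinarith, ?_⟩
      convert key using 1
      linear_combination -hsq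
    · simp [applyM, phim, IsExchangeCoding] at h1 h2 key ⊢
      refine ⟨by nlinarith, by nlinarith, by nlinarith, by nlinarith, ?_⟩
      convert key using 1
      linear_combination -2 * hsq
    · simp [applyM, phim, IsExchangeCoding] at h1 h2 key ⊢
      refine ⟨by nlinarith, by nlinarith, by nlinarith, by nlinarith, by nlinarith,
        by nlinarith, ?_⟩
      convert key using 1
      linear_combination -3 * hsq

lemma isRotationCoding_sub_even (W : List (Fin 2)) :
    ∀ (y : ℝ) (n : ℤ), IsRotationCoding (y - 2 * n) W ↔ IsRotationCoding y W := by
  induction W with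
  | nil => intro y n; exact Iff.rfl
  | cons c W ih =>
    intro y n
    have h : ⌊y - 2 * n⌋ = ⌊y⌋ - 2 * n := by
      have := Int.floor_sub_intCast y (2 * n)
      push_cast at this
      exact this
    rw [IsRotationCoding, IsRotationCoding, h, sub_right_comm, ih]
    have : (⌊y⌋ - 2 * n) % 2 = ⌊y⌋ % 2 := by omega
    rw [this]

lemma IsExchangeCoding.applyM_taum {w : List (Fin 3)} :
    ∀ {y : ℝ}, IsExchangeCoding y w → IsRotationCoding y (applyM taum w) := by
  induction w with
  | nil => intro y _; trivial
  | cons c w ih =>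
    rintro y ⟨h1, h2, h3⟩
    have key := ih h3
    obtain ⟨hl, hr⟩ := sqrt_two_bounds
    fin_cases c
    · simp [applyM, taum, IsRotationCoding] at h1 h2 key ⊢
      have f0 : ⌊y⌋ = 0 := by rw [Int.floor_eq_iff]; constructor <;> norm_num <;> linarith
      refine ⟨by omega, ?_⟩
      rw [← isRotationCoding_sub_even _ _ (-1)]
      convert key using 1
      push_cast
      ring
    · simp [applyM, taum, IsRotationCoding] at h1 h2 key ⊢
      have f0 : ⌊y⌋ = 0 := by rw [Int.floor_eq_iff]; constructor <;> norm_num <;> linarith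
      have f1 : ⌊y - √2⌋ = -1 := by rw [Int.floor_eq_iff]; constructor <;> norm_num <;> linarith
      refine ⟨by omega, by omega, ?_⟩
      rw [← isRotationCoding_sub_even _ _ (-1)]
      convert key using 1
      push_cast
      ring
    · simp [applyM, taum, IsRotationCoding] at h1 h2 key ⊢
      have f0 : ⌊y⌋ = 0 := by rw [Int.floor_eq_iff]; constructor <;> norm_num <;> linarith
      have f1 : ⌊y - √2⌋ = -1 := by rw [Int.floor_eq_iff]; constructor <;> norm_num <;> linarith
      have f2 : ⌊y - √2 - √2⌋ = -3 := by
        rw [Int.floor_eq_iff]; constructor <;> norm_num <;> linarith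
      refine ⟨by omega, by omega, by omega, ?_⟩
      rw [← isRotationCoding_sub_even _ _ (-2)]
      convert key using 1
      push_cast
      ring

lemma IsRotationCoding.getElem? {W : List (Fin 2)} :
    ∀ {y : ℝ}, IsRotationCoding y W → ∀ {i : ℕ} {c : Fin 2}, W[i]? = some c →
      ⌊y - i * √2⌋ % 2 = (c : ℕ) := by
  induction W with
  | nil => intro y _ i c h; simp at h
  | cons d W ih =>
    rintro y ⟨h1, h2⟩ i c h
    cases i with
    | zero =>
      simp only [List.getElem?_cons_zero, Option.some.injEq] at h
      simpa [← h] using h1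
    | succ i =>
      rw [List.getElem?_cons_succ] at h
      have := ih h2 h
      rw [← this]
      push_cast
      ring_nf

lemma phipow_succ (n : ℕ) (w : List (Fin 3)) : phipow (n + 1) w = applyM phim (phipow n w) :=
  Function.iterate_succ_apply' _ _ _

/-- The starting point of the coding is the fixed point of `y ↦ (√2 - 1)(1 - y)`. -/
lemma isExchangeCoding_phipow (n : ℕ) : IsExchangeCoding (1 - √2 / 2) (phipow n [0]) := by
  induction n with
  | zero =>
    obtain ⟨hl, hr⟩ := sqrt_two_bounds
    simp only [phipow, Function.iterate_zero, id, IsExchangeCoding]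
    simp
    constructor <;> linarith
  | succ n ih =>
    rw [phipow_succ]
    convert ih.applyM_phim using 1
    linear_combination (-1 / 2) * sqrt_two_mul_self

lemma isRotationCoding_phipow (n : ℕ) :
    IsRotationCoding (1 - √2 / 2) (applyM taum (phipow n [0])) :=
  (isExchangeCoding_phipow n).applyM_taum

lemma length_mul_le_length_applyM {α β : Type*} {h : α → List β} {k : ℕ}
    (hk : ∀ c, k ≤ (h c).length) (w : List α) : w.length * k ≤ (applyM h w).length := by
  induction w with
  | nil => simp [applyM]
  | cons c w ih =>
    have := hk c
    simp only [applyM, List.flatMap_cons, List.length_append, List.length_cons] at ih ⊢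
    linarith [add_mul w.length 1 k]

lemma lt_length_applyM_taum_phipow (n : ℕ) : n < (applyM taum (phipow n [0])).length := by
  have h1 : ∀ n, 2 ^ n ≤ (phipow n [0]).length := by
    intro n
    induction n with
    | zero => simp [phipow]
    | succ n ih =>
      have := length_mul_le_length_applyM (h := phim) (k := 2) (by decide) (phipow n [0])
      rw [phipow_succ, pow_succ]
      omega
  have h2 := length_mul_le_length_applyM (h := taum) (k := 1) (by decide) (phipow n [0])
  have h3 := h1 n
  have := n.lt_two_pow_self
  omega

/-! ### The upper bound -/

lemma floor_sub_eq_of_fract_lt {z δ : ℝ} (hδ : δ ≤ 1) (hz : Int.fract z < δ) :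
    ⌊z - δ⌋ = ⌊z⌋ - 1 := by
  have h0 := Int.fract_nonneg z
  have hf := Int.self_sub_floor z
  rw [Int.floor_eq_iff]
  push_cast
  constructor <;> linarith

lemma irrational_neg_sqrt_two : Irrational (-√2) := irrational_sqrt_two.neg

lemma exists_even_approx (p : ℕ) (hp : 0 < p) :
    ∃ m : ℕ, 0 < m ∧ |2 * m - p * √2| ≤ 1 ∧ 2 * (m : ℝ) - p * √2 ≠ 0 := by
  obtain ⟨hl, hr⟩ := sqrt_two_bounds
  have hp1 : (1 : ℝ) ≤ p := by exact_mod_cast hp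
  have h0 : 0 ≤ p * √2 / 2 + 1 / 2 := by positivity
  refine ⟨⌊p * √2 / 2 + 1 / 2⌋₊, ?_, ?_, ?_⟩
  · rw [Nat.floor_pos]
    nlinarith
  · have h1 := Nat.floor_le h0
    have h2 := Nat.lt_floor_add_one (p * √2 / 2 + 1 / 2)
    rw [abs_le]
    constructor <;> linarith
  · intro h
    refine (irrational_sqrt_two.natCast_mul hp.ne').ne_nat (2 * ⌊p * √2 / 2 + 1 / 2⌋₊) ?_
    push_cast
    linarith

lemma IsPeriod.length_le {W w : List (Fin 2)} {y : ℝ} (hW : IsRotationCoding y W)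
    (hw : w <:+: W) {p : ℕ} (hp : IsPeriod w p) : (w.length : ℝ) ≤ (2 + √2 / 2) * p := by
  obtain ⟨s, t, rfl⟩ := hw
  obtain ⟨hp0, -, hper⟩ := hp
  obtain ⟨m, hm0, hm1, hm2⟩ := exists_even_approx p hp0
  have hletter : ∀ i < w.length, ∃ c : Fin 2, w[i]? = some c ∧
      ⌊y - s.length * √2 - i * √2⌋ % 2 = (c : ℕ) := by
    intro i hi
    refine ⟨w[i], List.getElem?_eq_getElem hi, ?_⟩
    rw [← hW.getElem? (i := s.length + i) (c := w[i])]
    · push_cast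
      ring_nf
    · rw [List.append_assoc, List.getElem?_append_right (by omega)]
      simp [List.getElem?_append_left, hi]
  set x := y - s.length * √2 with hx
  have heq : ∀ i : ℕ, i + p < w.length →
      ⌊x - i * √2⌋ % 2 = ⌊x - i * √2 + (2 * m - p * √2)⌋ % 2 := by
    intro i hi
    obtain ⟨c, hc, hc'⟩ := hletter i (by omega)
    obtain ⟨d, hd, hd'⟩ := hletter (i + p) hi
    have hcd := hper i hi
    rw [hc, hd, Option.some.injEq] at hcd
    have h : x - i * √2 + (2 * m - p * √2) = x - ((i + p : ℕ) : ℝ) * √2 + ((2 * m : ℤ) : ℝ) := by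
      push_cast; ring
    rw [h, Int.floor_add_intCast, hc', hcd, ← hd']
    omega
  have hsq := sqrt_two_mul_self
  obtain ⟨hl, hr⟩ := sqrt_two_bounds
  have hlen : w.length < p + m + p := by
    by_contra! hlong
    rcases lt_or_gt_of_ne hm2 with he | he
    · obtain ⟨i, hi0, hi, hif⟩ := exists_hit_in_window (δ := p * √2 - 2 * m)
        irrational_neg_sqrt_two hm0 hp0 (k := -p) (l := -(2 * m))
        (u := p - m * √2) (v := p * √2 - 2 * m) (by push_cast; ring) (by push_cast; ring)
        (by nlinarith) (by linarith) (by nlinarith) le_rfl x 0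
      lift i to ℕ using hi0
      have h1 := floor_sub_eq_of_fract_lt (by linarith [(abs_le.1 hm1).1]) hif
      have h2 := heq i (by omega)
      have e1 : x + ((i : ℤ) : ℝ) * -√2 - (p * √2 - 2 * m)
        = x - i * √2 + (2 * m - p * √2) := by push_cast; ring
      have e2 : x + ((i : ℤ) : ℝ) * -√2 = x - i * √2 := by push_cast; ring
      rw [e1, e2] at h1
      omega
    · obtain ⟨i, hi0, hi, hif⟩ := exists_hit_in_window (δ := 2 * m - p * √2)
        irrational_neg_sqrt_two hp0 hm0 (k := -(2 * m)) (l := -p)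
        (u := 2 * m - p * √2) (v := m * √2 - p) (by push_cast; ring) (by push_cast; ring)
        (by linarith) (by nlinarith) le_rfl (by nlinarith) (x + (2 * m - p * √2)) 0
      lift i to ℕ using hi0
      have h1 := floor_sub_eq_of_fract_lt (by linarith [(abs_le.1 hm1).2]) hif
      have h2 := heq i (by omega)
      have e1 : x + (2 * m - p * √2) + ((i : ℤ) : ℝ) * -√2
        = x - i * √2 + (2 * m - p * √2) := by push_cast; ring
      rw [e1, add_sub_cancel_right] at h1
      omega
  have h1 : (w.length : ℝ) + 1 ≤ p + m + p := by exact_mod_cast hlen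
  linarith [(abs_le.1 hm1).2]

/-! ### The lower bound -/

lemma exists_large_pell (B : ℕ) :
    ∃ p q : ℕ, B < p ∧ 0 < q ∧ (p : ℤ) ^ 2 - 2 * q ^ 2 = 1 := by
  induction B with
  | zero => exact ⟨3, 2, by norm_num⟩
  | succ B ih =>
    obtain ⟨p, q, hp, hq, h⟩ := ih
    refine ⟨3 * p + 4 * q, 2 * p + 3 * q, by omega, by omega, ?_⟩
    push_cast
    linear_combination h

lemma pell_bounds {p q : ℕ} (hp : 0 < p) (h : (p : ℤ) ^ 2 - 2 * q ^ 2 = 1) :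
    0 < p - q * √2 ∧ (p - q * √2) * p ≤ 1 := by
  have hsq := sqrt_two_mul_self
  have hR : (p : ℝ) ^ 2 - 2 * q ^ 2 = 1 := by exact_mod_cast h
  have hp' : (0 : ℝ) < p := by exact_mod_cast hp
  have hq : 0 ≤ q * √2 := by positivity
  have hprod : (p - q * √2) * (p + q * √2) = 1 := by
    linear_combination hR - (q : ℝ) ^ 2 * hsq
  have h0 : 0 < p - q * √2 := by
    by_contra! hneg
    nlinarith
  exact ⟨h0, by nlinarith⟩

lemma exists_nat_fract_mem (x : ℝ) {c d : ℝ} (hc : 0 ≤ c) (hcd : c < d) (hd : d ≤ 1) :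
    ∃ i : ℕ, c ≤ Int.fract (x - i * √2) ∧ Int.fract (x - i * √2) < d := by
  obtain ⟨B, hB⟩ := exists_nat_gt (2 / (d - c))
  obtain ⟨p, q, hBp, hq, hpq⟩ := exists_large_pell B
  have hp : 0 < p := by omega
  obtain ⟨hu, hup⟩ := pell_bounds hp hpq
  have hsq := sqrt_two_mul_self
  obtain ⟨hl, hr⟩ := sqrt_two_bounds
  have hp' : (0 : ℝ) < p := by exact_mod_cast hp
  have hBp' : (B : ℝ) < p := by exact_mod_cast hBp
  have hdc : 2 < p * (d - c) := by
    rw [div_lt_iff₀ (by linarith)] at hB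
    nlinarith
  have hv : p * √2 - 2 * q = √2 * (p - q * √2) := by linear_combination (q : ℝ) * hsq
  have hvd : p * √2 - 2 * q ≤ d - c := by
    rw [hv]
    by_contra! hlt
    nlinarith
  obtain ⟨i, hi0, -, hif⟩ := exists_hit_in_window (δ := d - c)
    irrational_neg_sqrt_two hq hp (k := -p) (l := -(2 * q))
    (u := p - q * √2) (v := p * √2 - 2 * q) (by push_cast; ring) (by push_cast; ring)
    hu (by nlinarith) (by nlinarith) hvd (x - c) 0
  lift i to ℕ using hi0
  refine ⟨i, ?_⟩
  have h0 := Int.fract_nonneg (x - c + ((i : ℤ) : ℝ) * -√2)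
  have hf := Int.self_sub_floor (x - c + ((i : ℤ) : ℝ) * -√2)
  have : Int.fract (x - i * √2) = c + Int.fract (x - c + ((i : ℤ) : ℝ) * -√2) := by
    rw [Int.fract_eq_iff]
    refine ⟨by linarith, by linarith, ⌊x - c + ((i : ℤ) : ℝ) * -√2⌋, ?_⟩
    rw [← hf]
    push_cast
    ring
  rw [this]
  constructor <;> linarith

lemma floor_sub_eq_of_le_fract {z δ : ℝ} (hδ : 0 ≤ δ) (hz : δ ≤ Int.fract z) :
    ⌊z - δ⌋ = ⌊z⌋ := by
  have h1 := Int.fract_lt_one z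
  have hf := Int.self_sub_floor z
  rw [Int.floor_eq_iff]
  constructor <;> linarith

lemma exists_factor_of_pell {p q : ℕ} (hp : 2 ≤ p) (hq : 0 < q)
    (h : (p : ℤ) ^ 2 - 2 * q ^ 2 = 1) :
    ∃ (n : ℕ) (w : List (Fin 2)), w.length = 2 * p + q - 1 ∧
      w <:+: applyM taum (phipow n [0]) ∧ IsPeriod w p := by
  obtain ⟨hu, hup⟩ := pell_bounds (by omega) h
  have hsq := sqrt_two_mul_self
  obtain ⟨hl, hr⟩ := sqrt_two_bounds
  have hp' : (2 : ℝ) ≤ p := by exact_mod_cast hp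
  have hv : p * √2 - 2 * q = √2 * (p - q * √2) := by linear_combination (q : ℝ) * hsq
  have hv1 : p * √2 - 2 * q ≤ 1 := by nlinarith
  obtain ⟨i, hi1, hi2⟩ := exists_nat_fract_mem (1 - √2 / 2)
    (c := (p * √2 - 2 * q) - (p - q * √2)) (d := p * √2 - 2 * q)
    (by nlinarith) (by linarith) hv1
  have hmatch : ∀ j : ℕ, 0 < j → j < p + q →
      ⌊1 - √2 / 2 - ((i + j : ℕ) : ℝ) * √2⌋ % 2 =
        ⌊1 - √2 / 2 - ((i + j + p : ℕ) : ℝ) * √2⌋ % 2 := by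
    intro j hj0 hj
    have hnot := not_hit_of_lt_add (θ := -√2) (δ := p * √2 - 2 * q) (a := q) (b := p)
      (k := -p) (l := -(2 * q)) (u := p - q * √2) (v := p * √2 - 2 * q)
      (by linear_combination h) (by push_cast; ring) (by push_cast; ring) hu
      (by nlinarith) hi2 (by linarith) (j := j) (by omega) (by omega)
    have hfl := floor_sub_eq_of_le_fract (by nlinarith) hnot
    have e1 : 1 - √2 / 2 - i * √2 + ((j : ℤ) : ℝ) * -√2
      = 1 - √2 / 2 - ((i + j : ℕ) : ℝ) * √2 := by push_cast; ring
    have e2 : 1 - √2 / 2 - ((i + j : ℕ) : ℝ) * √2 - (p * √2 - 2 * q)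
      = 1 - √2 / 2 - ((i + j + p : ℕ) : ℝ) * √2 + ((2 * q : ℤ) : ℝ) := by push_cast; ring
    rw [e1, e2, Int.floor_add_intCast] at hfl
    omega
  set n := i + 1 + (2 * p + q - 1) with hn
  have hlen := lt_length_applyM_taum_phipow n
  have hcod := isRotationCoding_phipow n
  set W := applyM taum (phipow n [0])
  have hwlen : ((W.drop (i + 1)).take (2 * p + q - 1)).length = 2 * p + q - 1 := by
    rw [List.length_take, List.length_drop]
    omega
  refine ⟨n, (W.drop (i + 1)).take (2 * p + q - 1), hwlen,
    (List.take_prefix _ _).isInfix.trans (List.drop_suffix _ _).isInfix, by omega, by omega, ?_⟩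
  intro j hj
  rw [hwlen] at hj
  have h1 : i + (j + 1) < W.length := by omega
  have h2 : i + (j + 1) + p < W.length := by omega
  have hc := hcod.getElem? (List.getElem?_eq_getElem h1)
  have hd := hcod.getElem? (List.getElem?_eq_getElem h2)
  have hm := hmatch (j + 1) (by omega) (by omega)
  rw [hc, hd] at hm
  rw [List.getElem?_take_of_lt (by omega), List.getElem?_take_of_lt (by omega),
    List.getElem?_drop, List.getElem?_drop, show i + 1 + j = i + (j + 1) by ring,
    show i + 1 + (j + p) = i + (j + 1) + p by ring, List.getElem?_eq_getElem h1,
    List.getElem?_eq_getElem h2, Option.some.injEq]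
  exact Fin.ext (by exact_mod_cast hm)

theorem stmt9 :
    sSup {e : ℝ | ∃ (n : ℕ) (w : List (Fin 2)) (p : ℕ),
        w ≠ [] ∧ w <:+: applyM taum (phipow n [0]) ∧ IsPeriod w p ∧
        e = (w.length : ℝ) / p} = 2 + Real.sqrt 2 / 2 := by
  have hlarge : ∀ x < 2 + √2 / 2, ∃ e ∈ {e : ℝ | ∃ (n : ℕ) (w : List (Fin 2)) (p : ℕ),
      w ≠ [] ∧ w <:+: applyM taum (phipow n [0]) ∧ IsPeriod w p ∧
      e = (w.length : ℝ) / p}, x < e := by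
    intro x hx
    obtain ⟨B, hB⟩ := exists_nat_gt (2 / (2 + √2 / 2 - x))
    obtain ⟨p, q, hp, hq, hpq⟩ := exists_large_pell (B + 1)
    obtain ⟨n, w, hlen, hw, hper⟩ := exists_factor_of_pell (by omega) hq hpq
    refine ⟨_, ⟨n, w, p, List.ne_nil_of_length_pos (by omega), hw, hper, rfl⟩, ?_⟩
    obtain ⟨hu, hup⟩ := pell_bounds (by omega) hpq
    have hsq := sqrt_two_mul_self
    obtain ⟨hl, hr⟩ := sqrt_two_bounds
    have hp' : (B : ℝ) + 1 < p := by exact_mod_cast hp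
    have hB0 : (0 : ℝ) ≤ B := B.cast_nonneg
    have hlenR : (w.length : ℝ) = 2 * p + q - 1 := by
      have : w.length + 1 = 2 * p + q := by omega
      rw [eq_sub_iff_add_eq]
      exact_mod_cast this
    rw [div_lt_iff₀ (by linarith)] at hB
    rw [lt_div_iff₀ (by linarith), hlenR]
    have hq2 : (q : ℝ) = (√2 / 2) * p - √2 / 2 * (p - q * √2) := by
      linear_combination (-q / 2 : ℝ) * hsq
    have hu1 : p - q * √2 ≤ 1 := by nlinarith
    nlinarith
  refine csSup_eq_of_forall_le_of_forall_lt_exists_gt ?_ ?_ hlarge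
  · obtain ⟨e, he, -⟩ := hlarge 0 (by positivity)
    exact ⟨e, he⟩
  · rintro e ⟨n, w, p, -, hw, hper, rfl⟩
    rw [div_le_iff₀ (by exact_mod_cast hper.1)]
    exact hper.length_le (isRotationCoding_phipow n) hw
end
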